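/- Let Δ be a Delzant polygon with vertices p₁, …, p_d labeled in clockwise order starting from the lexicographically minimal vertex, and let ℓᵢ be the SL₂(ℤ)-length of the edge from pᵢ to pᵢ₊₁ (indices taken cyclically mod d). Then the map Λ : 𝒫_T(Δ) → ℝᵈ sending a packing to the tuple of SL₂(ℤ)-sizes of its triangles is a bijection from 𝒫_T(Δ) onto the compact convex polytope 𝒫̃_T(Δ) = {(λ₁, …, λ_d) ∈ ℝᵈ : λᵢ ≥ 0 and λᵢ + λᵢ₊₁ ≤ ℓᵢ for all i (cyclically)}, and moreover area(P) = ½‖Λ(P)‖² for every packing P ∈ 𝒫_T(Δ). -/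

import Mathlib

open Matrix MeasureTheory Set

/-- Points of the plane. -/
abbrev Pt := Fin 2 → ℝ

/-- The action of `SL₂(ℤ)` on `ℝ²` by matrix-vector multiplication. -/
noncomputable def sl2Apply (M : Matrix.SpecialLinearGroup (Fin 2) ℤ) (x : Pt) : Pt :=
  ((M : Matrix (Fin 2) (Fin 2) ℤ).map (Int.cast : ℤ → ℝ)).mulVec x

/-- The model triangle `B(λ) = {(x,y) : x ≥ 0, y ≥ 0, x + y < λ}`. -/
def modelTriangle (lam : ℝ) : Set Pt :=
  {x | 0 ≤ x 0 ∧ 0 ≤ x 1 ∧ x 0 + x 1 < lam}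

/-- The area (Lebesgue measure) of a subset of the plane. -/
noncomputable def area (S : Set Pt) : ℝ := (volume S).toReal

/-- `B ⊆ Δ` is an admissibly packed triangle at the point `p` of `SL₂(ℤ)`-size `lam`:
`B = M (B(lam)) + p` for some `M ∈ SL₂(ℤ)` and `B` coincides with `Δ`
in a neighborhood of `p`. -/
def IsPackedTriangle (Δ : Set Pt) (p : Pt) (lam : ℝ) (B : Set Pt) : Prop :=
  0 < lam ∧ B ⊆ Δ ∧
  (∃ M : Matrix.SpecialLinearGroup (Fin 2) ℤ,
      B = (fun x => sl2Apply M x + p) '' modelTriangle lam) ∧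
  ∃ U : Set Pt, IsOpen U ∧ p ∈ U ∧ B ∩ U = Δ ∩ U

/-- `P` is a (toric) packing of the convex polygon with vertices `V`, where the triangle
packed at the vertex `V i` has `SL₂(ℤ)`-size `sz i` (with `sz i = 0` if no triangle is
packed there): `P` is a union of pairwise disjoint admissibly packed triangles. -/
def IsPacking {k : ℕ} (V : Fin k → Pt) (sz : Fin k → ℝ) (P : Set Pt) : Prop :=
  ∃ tri : Fin k → Set Pt,
    P = (⋃ i, tri i) ∧
    (∀ i, (sz i = 0 ∧ tri i = ∅) ∨
       IsPackedTriangle (convexHull ℝ (Set.range V)) (V i) (sz i) (tri i)) ∧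
    Pairwise (Function.onFun Disjoint tri)

/-- The set of densities `area P / area Δ` of packings `P` of the polygon with
vertices `V`; the toric packing density `ρ_T` is its supremum. -/
def densitySet {k : ℕ} (V : Fin k → Pt) : Set ℝ :=
  {r : ℝ | ∃ sz P, IsPacking V sz P ∧ r = area P / area (convexHull ℝ (Set.range V))}

/-- The determinant of a pair of integer vectors in the plane. -/
def detZ (u v : Fin 2 → ℤ) : ℤ := u 0 * v 1 - u 1 * v 0

/-- `V, dir, len` describe a Delzant polygon with `k` vertices `V i`, listed in clockwise
order: the edge from `V i` to `V (i+1)` is directed along the primitive integer vector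
`dir i` and has `SL₂(ℤ)`-length `len i`, and each vertex satisfies the Delzant
condition `det (u₁, u₂) = ± 1`. -/
structure IsDelzantPolygon {k : ℕ} [NeZero k] (V : Fin k → Pt)
    (dir : Fin k → Fin 2 → ℤ) (len : Fin k → ℝ) : Prop where
  three_le : 3 ≤ k
  len_pos : ∀ i, 0 < len i
  primitive : ∀ i, Int.gcd (dir i 0) (dir i 1) = 1
  edge_eq : ∀ i j, V (i + 1) j - V i j = len i * (dir i j : ℝ)
  clockwise : ∀ i, detZ (dir i) (dir (i + 1)) < 0
  delzant : ∀ i, detZ (dir i) (dir (i + 1)) = 1 ∨ detZ (dir i) (dir (i + 1)) = -1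
  edges_boundary : ∀ i, segment ℝ (V i) (V (i + 1)) ⊆ frontier (convexHull ℝ (Set.range V))

/-- The lattice distance from `x` to the line through the `i`-th edge, positive on the right of
`dir i`. -/
def edgeDist {k : ℕ} (V : Fin k → Pt) (dir : Fin k → Fin 2 → ℤ) (i : Fin k) (x : Pt) : ℝ :=
  dir i 1 * (x 0 - V i 0) - dir i 0 * (x 1 - V i 1)

/-- The corner of size `lam` cut off at the vertex `V i` by the lattice distances to the two
adjacent edges. -/
def cornerTriangle {k : ℕ} [NeZero k] (V : Fin k → Pt) (dir : Fin k → Fin 2 → ℤ) (i : Fin k)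
    (lam : ℝ) : Set Pt :=
  {x | 0 ≤ edgeDist V dir (i - 1) x ∧ 0 ≤ edgeDist V dir i x ∧
    edgeDist V dir (i - 1) x + edgeDist V dir i x < lam}

theorem Fin.cyclic_induction {k : ℕ} [NeZero k] {p : Fin k → Prop} (zero : p 0)
    (step : ∀ i, p i → p (i + 1)) (i : Fin k) : p i := by
  obtain _ | n := k
  · exact i.elim0
  · induction i using Fin.induction with
    | zero => exact zero
    | succ i ih => simpa [Fin.coeSucc_eq_succ] using step _ ih

theorem Fin.self_ne_add_one {k : ℕ} [NeZero k] (hk : 2 ≤ k) (i : Fin k) : i ≠ i + 1 := by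
  obtain ⟨n, rfl⟩ := Nat.exists_eq_add_of_le' hk
  intro h
  exact one_ne_zero (α := Fin (n + 2)) (left_eq_add.mp h)

theorem continuous_edgeDist {k : ℕ} (V : Fin k → Pt) (dir : Fin k → Fin 2 → ℤ) (i : Fin k) :
    Continuous (edgeDist V dir i) := by
  unfold edgeDist
  fun_prop

theorem vertex_mem_convexHull {k : ℕ} (V : Fin k → Pt) (i : Fin k) :
    V i ∈ convexHull ℝ (range V) :=
  subset_convexHull ℝ _ (mem_range_self i)

theorem edgeDist_self {k : ℕ} (V : Fin k → Pt) (dir : Fin k → Fin 2 → ℤ) (i : Fin k) :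
    edgeDist V dir i (V i) = 0 := by
  simp [edgeDist]

theorem edgeDist_combo {k : ℕ} (V : Fin k → Pt) (dir : Fin k → Fin 2 → ℤ) (i : Fin k)
    {a b : ℝ} (hab : a + b = 1) (x y : Pt) :
    edgeDist V dir i (a • x + b • y) = a * edgeDist V dir i x + b * edgeDist V dir i y := by
  obtain rfl : b = 1 - a := by linarith
  simp only [edgeDist, Pi.add_apply, Pi.smul_apply, smul_eq_mul]
  ring

theorem cornerTriangle_zero {k : ℕ} [NeZero k] (V : Fin k → Pt) (dir : Fin k → Fin 2 → ℤ)
    (i : Fin k) : cornerTriangle V dir i 0 = ∅ := by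
  ext x
  simp only [cornerTriangle, mem_ofPred_eq, mem_empty_iff_false, iff_false]
  rintro ⟨h₁, h₂, h₃⟩
  linarith

theorem chord_lt_of_mem_cornerTriangle {k : ℕ} [NeZero k] {V : Fin k → Pt}
    {dir : Fin k → Fin 2 → ℤ} {len : Fin k → ℝ} {i : Fin k} {lam : ℝ}
    (h₁ : lam ≤ len i) (h₂ : lam ≤ len (i - 1)) {x : Pt} (hx : x ∈ cornerTriangle V dir i lam) :
    edgeDist V dir (i - 1) x / len i + edgeDist V dir i x / len (i - 1) < 1 := by
  obtain ⟨hx₁, hx₂, hx₃⟩ := hx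
  have hlam : 0 < lam := by linarith
  calc _ ≤ edgeDist V dir (i - 1) x / lam + edgeDist V dir i x / lam := by gcongr
    _ < 1 := by rw [← add_div]; exact (div_lt_one hlam).mpr hx₃

theorem measurableSet_cornerTriangle {k : ℕ} [NeZero k] (V : Fin k → Pt)
    (dir : Fin k → Fin 2 → ℤ) (i : Fin k) (lam : ℝ) :
    MeasurableSet (cornerTriangle V dir i lam) := by
  have h₁ := (continuous_edgeDist V dir (i - 1)).measurable
  have h₂ := (continuous_edgeDist V dir i).measurable
  exact (measurableSet_le measurable_const h₁).inter
    ((measurableSet_le measurable_const h₂).inter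
      (measurableSet_lt (h₁.add h₂) measurable_const))

theorem sl2Apply_eq (M : Matrix.SpecialLinearGroup (Fin 2) ℤ) (x : Pt) (j : Fin 2) :
    sl2Apply M x j = M j 0 * x 0 + M j 1 * x 1 := by
  simp [sl2Apply, Matrix.mulVec, dotProduct, Fin.sum_univ_two]

theorem volume_modelTriangle {lam : ℝ} (hlam : 0 ≤ lam) :
    volume (modelTriangle lam) = ENNReal.ofReal (lam ^ 2 / 2) := by
  have hmp := MeasureTheory.volume_preserving_finTwoArrow ℝ
  have hS : MeasurableSet {p : ℝ × ℝ | 0 ≤ p.1 ∧ 0 ≤ p.2 ∧ p.1 + p.2 < lam} :=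
    (measurableSet_le measurable_const measurable_fst).inter
      ((measurableSet_le measurable_const measurable_snd).inter
        (measurableSet_lt (measurable_fst.add measurable_snd) measurable_const))
  have hpre : modelTriangle lam = MeasurableEquiv.finTwoArrow ⁻¹'
      {p : ℝ × ℝ | 0 ≤ p.1 ∧ 0 ≤ p.2 ∧ p.1 + p.2 < lam} := rfl
  rw [hpre, hmp.measure_preimage hS.nullMeasurableSet, Measure.volume_eq_prod,
    Measure.prod_apply hS]
  have hslice : ∀ x : ℝ,
      volume (Prod.mk x ⁻¹' {p : ℝ × ℝ | 0 ≤ p.1 ∧ 0 ≤ p.2 ∧ p.1 + p.2 < lam}) =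
        (Icc 0 lam).indicator (fun x => ENNReal.ofReal (lam - x)) x := by
    intro x
    by_cases hx : x ∈ Icc 0 lam
    · have : Prod.mk x ⁻¹' {p : ℝ × ℝ | 0 ≤ p.1 ∧ 0 ≤ p.2 ∧ p.1 + p.2 < lam} =
          Ico 0 (lam - x) := by
        ext y
        simp only [mem_preimage, mem_ofPred_eq, mem_Ico]
        constructor
        · rintro ⟨-, h₁, h₂⟩
          exact ⟨h₁, by linarith⟩
        · rintro ⟨h₁, h₂⟩
          exact ⟨hx.1, h₁, by linarith⟩
      rw [this, Real.volume_Ico, indicator_of_mem hx, sub_zero]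
    · have : Prod.mk x ⁻¹' {p : ℝ × ℝ | 0 ≤ p.1 ∧ 0 ≤ p.2 ∧ p.1 + p.2 < lam} = ∅ := by
        ext y
        simp only [mem_preimage, mem_ofPred_eq, mem_empty_iff_false, iff_false]
        rintro ⟨h₀, h₁, h₂⟩
        exact hx ⟨h₀, by linarith⟩
      rw [this, measure_empty, indicator_of_notMem hx]
  simp_rw [hslice]
  rw [lintegral_indicator measurableSet_Icc, ← ofReal_integral_eq_lintegral_ofReal]
  · rw [integral_Icc_eq_integral_Ioc, ← intervalIntegral.integral_of_le hlam]
    congr 1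
    rw [intervalIntegral.integral_sub (by simp) (by simp), integral_id,
      intervalIntegral.integral_const]
    simp
    ring
  · exact (continuous_const.sub continuous_id).integrableOn_Icc
  · filter_upwards [self_mem_ae_restrict measurableSet_Icc] with x hx
    exact sub_nonneg.mpr hx.2

theorem volume_image_modelTriangle (M : Matrix.SpecialLinearGroup (Fin 2) ℤ) (p : Pt) {lam : ℝ}
    (hlam : 0 ≤ lam) :
    volume ((fun x => sl2Apply M x + p) '' modelTriangle lam) =
      ENNReal.ofReal (lam ^ 2 / 2) := by
  have himage : (fun x => sl2Apply M x + p) '' modelTriangle lam =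
      (fun y => y + p) '' (Matrix.toLin'
        ((M : Matrix (Fin 2) (Fin 2) ℤ).map (Int.cast : ℤ → ℝ)) '' modelTriangle lam) := by
    rw [image_image]
    rfl
  have hdet : ((M : Matrix (Fin 2) (Fin 2) ℤ).map (Int.cast : ℤ → ℝ)).det = 1 := by
    have h := M.det_coe
    rw [Matrix.det_fin_two] at h ⊢
    simp only [Matrix.map_apply]
    exact_mod_cast h
  rw [himage, image_add_right, measure_preimage_add_right,
    Measure.addHaar_image_linearMap, LinearMap.det_toLin', hdet, volume_modelTriangle hlam]
  simp

namespace IsDelzantPolygon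

variable {k : ℕ} [NeZero k] {V : Fin k → Pt} {dir : Fin k → Fin 2 → ℤ} {len : Fin k → ℝ}

theorem det_eq (h : IsDelzantPolygon V dir len) (i : Fin k) :
    dir i 0 * dir (i + 1) 1 - dir i 1 * dir (i + 1) 0 = -1 := by
  have h₁ := h.clockwise i
  have h₂ := h.delzant i
  unfold detZ at h₁ h₂
  omega

theorem det_prev (h : IsDelzantPolygon V dir len) (i : Fin k) :
    dir (i - 1) 0 * dir i 1 - dir (i - 1) 1 * dir i 0 = -1 := by
  simpa using h.det_eq (i - 1)

theorem det_prev_real (h : IsDelzantPolygon V dir len) (i : Fin k) :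
    (dir (i - 1) 0 * dir i 1 - dir (i - 1) 1 * dir i 0 : ℝ) = -1 := by
  exact_mod_cast h.det_prev i

theorem det_eq_real (h : IsDelzantPolygon V dir len) (i : Fin k) :
    (dir i 0 * dir (i + 1) 1 - dir i 1 * dir (i + 1) 0 : ℝ) = -1 := by
  exact_mod_cast h.det_eq i

theorem vertex_add_one (h : IsDelzantPolygon V dir len) (i : Fin k) (j : Fin 2) :
    V (i + 1) j = V i j + len i * dir i j := by
  linarith [h.edge_eq i j]

theorem vertex_sub_one (h : IsDelzantPolygon V dir len) (i : Fin k) (j : Fin 2) :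
    V (i - 1) j = V i j - len (i - 1) * dir (i - 1) j := by
  have := h.edge_eq (i - 1) j
  rw [sub_add_cancel] at this
  linarith

theorem edgeDist_prev (h : IsDelzantPolygon V dir len) (i : Fin k) (x : Pt) :
    edgeDist V dir (i - 1) x =
      dir (i - 1) 1 * (x 0 - V i 0) - dir (i - 1) 0 * (x 1 - V i 1) := by
  simp only [edgeDist, h.vertex_sub_one]
  ring

/-- The lattice distances to the two edges at a vertex are affine coordinates on the plane. -/
theorem eq_vertex_add (h : IsDelzantPolygon V dir len) (i : Fin k) (x : Pt) (j : Fin 2) :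
    x j = V i j + edgeDist V dir (i - 1) x * dir i j - edgeDist V dir i x * dir (i - 1) j := by
  have hd := h.det_prev_real i
  rw [h.edgeDist_prev, edgeDist]
  fin_cases j
  · simp only [Fin.zero_eta]
    linear_combination (x 0 - V i 0) * hd
  · simp only [Fin.mk_one]
    linear_combination (x 1 - V i 1) * hd

theorem edgeDist_of_eq (h : IsDelzantPolygon V dir len) (i : Fin k) {x : Pt} {s t : ℝ}
    (hx : ∀ j, x j = V i j + s * dir i j - t * dir (i - 1) j) :
    edgeDist V dir (i - 1) x = s ∧ edgeDist V dir i x = t := by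
  have hd := h.det_prev_real i
  rw [h.edgeDist_prev, edgeDist, hx 0, hx 1]
  constructor
  · linear_combination (-s) * hd
  · linear_combination (-t) * hd

theorem edgeDist_prev_vertex (h : IsDelzantPolygon V dir len) (i : Fin k) :
    edgeDist V dir (i - 1) (V i) = 0 := by
  simp [h.edgeDist_prev]

theorem edgeDist_vertex_add_one (h : IsDelzantPolygon V dir len) (i : Fin k) :
    edgeDist V dir i (V (i + 1)) = 0 := by
  simpa using h.edgeDist_prev_vertex (i + 1)

theorem edgeDist_prev_vertex_add_one (h : IsDelzantPolygon V dir len) (i : Fin k) :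
    edgeDist V dir (i - 1) (V (i + 1)) = len i :=
  (h.edgeDist_of_eq i (t := 0) fun j => by rw [h.vertex_add_one]; ring).1

theorem edgeDist_vertex_sub_one (h : IsDelzantPolygon V dir len) (i : Fin k) :
    edgeDist V dir i (V (i - 1)) = len (i - 1) :=
  (h.edgeDist_of_eq i (s := 0) fun j => by rw [h.vertex_sub_one]; ring).2

theorem vertex_ne_add_one (h : IsDelzantPolygon V dir len) (i : Fin k) : V (i + 1) ≠ V i := by
  intro he
  have h₁ := h.edgeDist_prev_vertex_add_one i
  rw [he, h.edgeDist_prev_vertex] at h₁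
  exact (h.len_pos i).ne h₁

theorem mem_convexHull_of_chord_le (h : IsDelzantPolygon V dir len) (i : Fin k) {x : Pt}
    (h₁ : 0 ≤ edgeDist V dir (i - 1) x) (h₂ : 0 ≤ edgeDist V dir i x)
    (h₃ : edgeDist V dir (i - 1) x / len i + edgeDist V dir i x / len (i - 1) ≤ 1) :
    x ∈ convexHull ℝ {V i, V (i + 1), V (i - 1)} := by
  have hl := h.len_pos i
  have hl' := h.len_pos (i - 1)
  set s := edgeDist V dir (i - 1) x with hs
  set t := edgeDist V dir i x with ht
  have hx : x = (1 - (s / len i + t / len (i - 1))) • V i + (s / len i) • V (i + 1) +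
      (t / len (i - 1)) • V (i - 1) := by
    ext j
    simp only [Pi.add_apply, Pi.smul_apply, smul_eq_mul]
    rw [h.vertex_add_one, h.vertex_sub_one, h.eq_vertex_add i x j, ← hs, ← ht]
    field_simp
    ring
  have hs0 : 0 ≤ s / len i := div_nonneg h₁ hl.le
  have ht0 : 0 ≤ t / len (i - 1) := div_nonneg h₂ hl'.le
  have hmem := (convex_convexHull ℝ {V i, V (i + 1), V (i - 1)}).sum_mem (t := Finset.univ)
    (w := ![1 - (s / len i + t / len (i - 1)), s / len i, t / len (i - 1)])
    (z := ![V i, V (i + 1), V (i - 1)])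
    (by
      intro j _
      fin_cases j
      · exact sub_nonneg.mpr h₃
      · exact hs0
      · exact ht0)
    (by simp only [Fin.sum_univ_three, cons_val_zero, cons_val_one, cons_val]; ring)
    (by
      intro j _
      fin_cases j <;> exact subset_convexHull ℝ _ (by simp))
  rw [hx]
  simpa [Fin.sum_univ_three] using hmem

theorem mem_of_chord_le (h : IsDelzantPolygon V dir len) (i : Fin k) {x : Pt}
    (h₁ : 0 ≤ edgeDist V dir (i - 1) x) (h₂ : 0 ≤ edgeDist V dir i x)
    (h₃ : edgeDist V dir (i - 1) x / len i + edgeDist V dir i x / len (i - 1) ≤ 1) :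
    x ∈ convexHull ℝ (range V) := by
  refine convexHull_mono ?_ (h.mem_convexHull_of_chord_le i h₁ h₂ h₃)
  rintro _ (rfl | rfl | rfl) <;> exact mem_range_self _

theorem mem_interior_of_chord_lt (h : IsDelzantPolygon V dir len) (i : Fin k) {x : Pt}
    (h₁ : 0 < edgeDist V dir (i - 1) x) (h₂ : 0 < edgeDist V dir i x)
    (h₃ : edgeDist V dir (i - 1) x / len i + edgeDist V dir i x / len (i - 1) < 1) :
    x ∈ interior (convexHull ℝ (range V)) := by
  have hc₁ := continuous_edgeDist V dir (i - 1)
  have hc₂ := continuous_edgeDist V dir i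
  refine mem_interior.mpr ⟨{y | 0 < edgeDist V dir (i - 1) y} ∩ ({y | 0 < edgeDist V dir i y} ∩
    {y | edgeDist V dir (i - 1) y / len i + edgeDist V dir i y / len (i - 1) < 1}),
    fun y hy => h.mem_of_chord_le i (le_of_lt hy.1) (le_of_lt hy.2.1) (le_of_lt hy.2.2),
    ?_, h₁, h₂, h₃⟩
  exact (isOpen_lt continuous_const hc₁).inter ((isOpen_lt continuous_const hc₂).inter
    (isOpen_lt ((hc₁.div_const _).add (hc₂.div_const _)) continuous_const))

theorem interior_nonempty (h : IsDelzantPolygon V dir len) :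
    (interior (convexHull ℝ (range V))).Nonempty := by
  have hl := h.len_pos 0
  have hl' := h.len_pos (0 - 1)
  obtain ⟨h₁, h₂⟩ := h.edgeDist_of_eq 0
    (x := fun j => V 0 j + len 0 / 3 * dir 0 j - len (0 - 1) / 3 * dir (0 - 1) j)
    (fun _ => rfl)
  refine ⟨fun j => V 0 j + len 0 / 3 * dir 0 j - len (0 - 1) / 3 * dir (0 - 1) j,
    h.mem_interior_of_chord_lt 0 ?_ ?_ ?_⟩
  · rw [h₁]
    positivity
  · rw [h₂]
    positivity
  · rw [h₁, h₂]
    field_simp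
    norm_num

/-- The polygon lies on one side of each of its edges. -/
theorem edgeDist_nonneg (h : IsDelzantPolygon V dir len) (i : Fin k) {x : Pt}
    (hx : x ∈ convexHull ℝ (range V)) : 0 ≤ edgeDist V dir i x := by
  have hm : midpoint ℝ (V i) (V (i + 1)) ∉ interior (convexHull ℝ (range V)) :=
    (h.edges_boundary i (midpoint_mem_segment _ _)).2
  obtain ⟨f, hf, hmax⟩ := geometric_hahn_banach_of_nonempty_interior_point
    (convex_convexHull ℝ (range V)) hm h.interior_nonempty
  obtain ⟨α, β, hαβ⟩ : ∃ α β : ℝ, ∀ y, f y = α * y 0 + β * y 1 := by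
    refine ⟨f (Pi.single 0 1), f (Pi.single 1 1), fun y => ?_⟩
    have hy : y = y 0 • Pi.single 0 1 + y 1 • Pi.single 1 1 := by
      ext j
      fin_cases j <;> simp
    conv_lhs => rw [hy]
    simp only [map_add, map_smul, smul_eq_mul]
    ring
  have h₀ := hmax _ (vertex_mem_convexHull V i)
  have h₁ := hmax _ (vertex_mem_convexHull V (i + 1))
  have h₂ := hmax _ (vertex_mem_convexHull V (i + 1 + 1))
  have h₃ := hmax _ hx
  have hmid : f (midpoint ℝ (V i) (V (i + 1))) = (f (V i) + f (V (i + 1))) / 2 := by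
    rw [midpoint_eq_smul_add, map_smul, map_add, smul_eq_mul, invOf_eq_inv]
    ring
  rw [hmid] at h₀ h₁ h₂ h₃
  have hl := h.len_pos i
  have hl₁ := h.len_pos (i + 1)
  have hd := h.det_eq_real i
  have hpar : α * dir i 0 + β * dir i 1 = 0 := by
    have : len i * (α * dir i 0 + β * dir i 1) = 0 := by
      have he : f (V (i + 1)) = f (V i) := by linarith
      rw [hαβ, hαβ, h.vertex_add_one, h.vertex_add_one] at he
      linarith
    exact (mul_eq_zero.mp this).resolve_left hl.ne'
  have hc : α * dir (i + 1) 0 + β * dir (i + 1) 1 ≤ 0 := by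
    have : len (i + 1) * (α * dir (i + 1) 0 + β * dir (i + 1) 1) ≤ 0 := by
      have he : f (V (i + 1 + 1)) ≤ f (V (i + 1)) := by linarith
      rw [hαβ, hαβ, h.vertex_add_one (i + 1), h.vertex_add_one (i + 1)] at he
      linarith
    exact nonpos_of_mul_nonpos_right this hl₁
  set c := α * dir (i + 1) 0 + β * dir (i + 1) 1 with hcdef
  have hα : α = c * dir i 1 := by
    rw [hcdef]
    linear_combination α * hd - (dir (i + 1) 1 : ℝ) * hpar
  have hβ : β = -c * dir i 0 := by
    rw [hcdef]
    linear_combination β * hd + (dir (i + 1) 0 : ℝ) * hpar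
  have hc' : c < 0 := by
    refine lt_of_le_of_ne hc fun hc0 => hf ?_
    ext y
    simp [hαβ, hα, hβ, hc0]
  have hfx : f x ≤ f (V i) := by linarith
  rw [hαβ, hαβ, hα, hβ] at hfx
  have : c * edgeDist V dir i x ≤ 0 := by
    rw [edgeDist]
    linarith
  exact nonneg_of_mul_nonpos_right this hc'

theorem not_mem_interior (h : IsDelzantPolygon V dir len) (j : Fin k) :
    V j ∉ interior (convexHull ℝ (range V)) :=
  (h.edges_boundary j (left_mem_segment ℝ _ _)).2

/-- A vertex of the polygon does not lie between two other points of it. -/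
theorem eq_of_vertex_eq_combo (h : IsDelzantPolygon V dir len) (j : Fin k) {x y : Pt}
    (hx : x ∈ convexHull ℝ (range V)) (hy : y ∈ convexHull ℝ (range V)) {a b : ℝ}
    (ha : 0 < a) (hb : 0 < b) (hab : a + b = 1) (he : V j = a • x + b • y) : x = V j := by
  have aux : ∀ l, edgeDist V dir l (V j) = 0 → edgeDist V dir l x = 0 := by
    intro l hl
    rw [he, edgeDist_combo V dir l hab] at hl
    have h₁ := h.edgeDist_nonneg l hx
    have h₂ := mul_nonneg hb.le (h.edgeDist_nonneg l hy)
    have h₃ := mul_nonneg ha.le h₁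
    exact (mul_eq_zero.mp (by linarith : a * edgeDist V dir l x = 0)).resolve_left ha.ne'
  ext l
  rw [h.eq_vertex_add j x l, aux _ (h.edgeDist_prev_vertex j), aux _ (edgeDist_self V dir j)]
  simp

theorem vertex_not_mem_edge (h : IsDelzantPolygon V dir len) (i j : Fin k) {s : ℝ} (hs : 0 < s)
    (hs' : s < len i) (hj : ∀ l, V j l = V i l + s * dir i l) : False := by
  have hl := h.len_pos i
  have hlt : s / len i < 1 := (div_lt_one hl).mpr hs'
  have hpos : 0 < s / len i := div_pos hs hl
  have he : V j = (1 - s / len i) • V i + (s / len i) • V (i + 1) := by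
    ext l
    simp only [Pi.add_apply, Pi.smul_apply, smul_eq_mul]
    rw [hj, h.vertex_add_one]
    field_simp
    ring
  have h₁ := h.eq_of_vertex_eq_combo j (vertex_mem_convexHull V i)
    (vertex_mem_convexHull V (i + 1)) (sub_pos.mpr hlt) hpos (by ring) he
  rw [add_comm] at he
  have h₂ := h.eq_of_vertex_eq_combo j (vertex_mem_convexHull V (i + 1))
    (vertex_mem_convexHull V i) hpos (sub_pos.mpr hlt) (by ring) he
  exact h.vertex_ne_add_one i (h₂.trans h₁.symm)

theorem le_len_of_mem (h : IsDelzantPolygon V dir len) (i : Fin k) {c : ℝ} {x : Pt}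
    (hx : x ∈ convexHull ℝ (range V)) (hc : ∀ l, x l = V i l + c * dir i l) : c ≤ len i := by
  have h₁ := h.edgeDist_nonneg (i + 1) hx
  have hd := h.det_eq_real i
  rw [edgeDist, hc, hc, h.vertex_add_one, h.vertex_add_one] at h₁
  have h₂ : dir (i + 1) 1 * (V i 0 + c * dir i 0 - (V i 0 + len i * dir i 0)) -
      dir (i + 1) 0 * (V i 1 + c * dir i 1 - (V i 1 + len i * dir i 1)) = len i - c := by
    linear_combination (c - len i) * hd
  linarith

theorem le_len_prev_of_mem (h : IsDelzantPolygon V dir len) (i : Fin k) {c : ℝ} {x : Pt}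
    (hx : x ∈ convexHull ℝ (range V)) (hc : ∀ l, x l = V i l - c * dir (i - 1) l) :
    c ≤ len (i - 1) := by
  have h₁ := h.edgeDist_nonneg (i - 1 - 1) hx
  have hd := h.det_prev_real (i - 1)
  rw [h.edgeDist_prev, hc, hc, h.vertex_sub_one, h.vertex_sub_one] at h₁
  have h₂ : dir (i - 1 - 1) 1 *
        (V i 0 - c * dir (i - 1) 0 - (V i 0 - len (i - 1) * dir (i - 1) 0)) -
      dir (i - 1 - 1) 0 *
        (V i 1 - c * dir (i - 1) 1 - (V i 1 - len (i - 1) * dir (i - 1) 1)) =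
      len (i - 1) - c := by
    linear_combination (c - len (i - 1)) * hd
  linarith

theorem vertex_add_one_eq (h : IsDelzantPolygon V dir len) {i j : Fin k} (hij : V i = V j) :
    V (i + 1) = V (j + 1) := by
  have h₁ := h.edgeDist_nonneg j (vertex_mem_convexHull V (i + 1))
  have h₂ := h.edgeDist_nonneg i (vertex_mem_convexHull V (j + 1))
  have hj : edgeDist V dir j (V (i + 1)) = 0 := by
    refine le_antisymm ?_ h₁
    rw [edgeDist, h.vertex_add_one, h.vertex_add_one, ← hij] at h₁ ⊢
    rw [edgeDist, h.vertex_add_one, h.vertex_add_one, hij] at h₂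
    have h₃ : 0 ≤ len j * (dir i 1 * dir j 0 - dir i 0 * dir j 1 : ℝ) := by linarith
    have h₄ := mul_nonneg (h.len_pos i).le (nonneg_of_mul_nonneg_right h₃ (h.len_pos j))
    linarith
  have hx : ∀ l, V (i + 1) l = V j l + edgeDist V dir (j - 1) (V (i + 1)) * dir j l := by
    intro l
    conv_lhs => rw [h.eq_vertex_add j (V (i + 1)) l, hj]
    ring
  have hle := h.le_len_of_mem j (vertex_mem_convexHull V (i + 1)) hx
  obtain hs | hs := (h.edgeDist_nonneg (j - 1) (vertex_mem_convexHull V (i + 1))).eq_or_lt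
  · refine (h.vertex_ne_add_one i ?_).elim
    ext l
    rw [hx, ← hs, hij]
    ring
  · obtain hlt | heq := hle.lt_or_eq
    · exact (h.vertex_not_mem_edge j (i + 1) hs hlt hx).elim
    · ext l
      rw [hx, heq, h.vertex_add_one]

theorem vertex_injective (h : IsDelzantPolygon V dir len) (h0 : ∀ i, i ≠ 0 → V i ≠ V 0) :
    Function.Injective V := by
  intro i j hij
  have key : ∀ m, V (i + m) = V (j + m) := by
    refine Fin.cyclic_induction (by simpa using hij) fun m hm => ?_
    simpa [add_assoc] using h.vertex_add_one_eq hm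
  have h₁ := key (-j)
  rw [add_neg_cancel] at h₁
  by_contra hne
  exact h0 _ (fun h₂ => hne (add_neg_eq_zero.mp h₂)) h₁

/-- The other vertices lie beyond the chord joining the two neighbours of a vertex. -/
theorem one_le_chord_vertex (h : IsDelzantPolygon V dir len) (hV : Function.Injective V)
    {i j : Fin k} (hij : j ≠ i) :
    1 ≤ edgeDist V dir (i - 1) (V j) / len i + edgeDist V dir i (V j) / len (i - 1) := by
  by_contra! hlt
  have hl := h.len_pos i
  have hl' := h.len_pos (i - 1)
  have hx := h.eq_vertex_add i (V j)
  obtain h₁ | h₁ := (h.edgeDist_nonneg (i - 1) (vertex_mem_convexHull V j)).eq_or_lt <;>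
  obtain h₂ | h₂ := (h.edgeDist_nonneg i (vertex_mem_convexHull V j)).eq_or_lt
  · refine hij (hV ?_)
    ext l
    rw [hx, ← h₁, ← h₂]
    ring
  · set t := edgeDist V dir i (V j) with ht
    rw [← h₁, zero_div, zero_add, div_lt_one hl'] at hlt
    refine h.vertex_not_mem_edge (i - 1) j (s := len (i - 1) - t) (by linarith) (by linarith)
      fun l => ?_
    rw [hx, ← h₁, h.vertex_sub_one]
    ring
  · set s := edgeDist V dir (i - 1) (V j) with hs
    rw [← h₂, zero_div, add_zero, div_lt_one hl] at hlt
    refine h.vertex_not_mem_edge i j h₁ hlt fun l => ?_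
    rw [hx, ← h₂]
    ring
  · exact h.not_mem_interior j (h.mem_interior_of_chord_lt i h₁ h₂ hlt)

theorem cornerTriangle_subset (h : IsDelzantPolygon V dir len) {i : Fin k} {lam : ℝ}
    (h₁ : lam ≤ len i) (h₂ : lam ≤ len (i - 1)) :
    cornerTriangle V dir i lam ⊆ convexHull ℝ (range V) :=
  fun _ hx => h.mem_of_chord_le i hx.1 hx.2.1 (chord_lt_of_mem_cornerTriangle h₁ h₂ hx).le

/-- The matrix whose columns direct the two edges at a vertex maps the model triangle to the
corner triangle. -/
theorem image_modelTriangle (h : IsDelzantPolygon V dir len) (i : Fin k)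
    {M : Matrix.SpecialLinearGroup (Fin 2) ℤ} (h₀ : ∀ j, M j 0 = -dir (i - 1) j)
    (h₁ : ∀ j, M j 1 = dir i j) (lam : ℝ) :
    (fun x => sl2Apply M x + V i) '' modelTriangle lam = cornerTriangle V dir i lam := by
  have happly : ∀ x : Pt, ∀ j,
      (sl2Apply M x + V i) j = V i j + x 1 * dir i j - x 0 * dir (i - 1) j := by
    intro x j
    rw [Pi.add_apply, sl2Apply_eq, h₀, h₁]
    push_cast
    ring
  ext y
  constructor
  · rintro ⟨x, ⟨hx₀, hx₁, hx₂⟩, rfl⟩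
    obtain ⟨hs, ht⟩ := h.edgeDist_of_eq i (happly x)
    refine ⟨hs.ge.trans' hx₁, ht.ge.trans' hx₀, ?_⟩
    simp only [hs, ht]
    linarith
  · rintro ⟨hy₀, hy₁, hy₂⟩
    refine ⟨![edgeDist V dir i y, edgeDist V dir (i - 1) y], ⟨hy₁, hy₀, ?_⟩, ?_⟩
    · simpa [add_comm] using hy₂
    · ext j
      exact (happly _ j).trans (h.eq_vertex_add i y j).symm

theorem exists_image_modelTriangle (h : IsDelzantPolygon V dir len) (i : Fin k) :
    ∃ M : Matrix.SpecialLinearGroup (Fin 2) ℤ, ∀ lam,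
      cornerTriangle V dir i lam = (fun x => sl2Apply M x + V i) '' modelTriangle lam := by
  have hd := h.det_prev i
  refine ⟨⟨!![-dir (i - 1) 0, dir i 0; -dir (i - 1) 1, dir i 1], ?_⟩, fun lam =>
    (h.image_modelTriangle i ?_ ?_ lam).symm⟩
  · rw [Matrix.det_fin_two_of]
    linarith
  · intro j
    fin_cases j <;> rfl
  · intro j
    fin_cases j <;> rfl

theorem volume_cornerTriangle (h : IsDelzantPolygon V dir len) (i : Fin k) {lam : ℝ}
    (hlam : 0 ≤ lam) : volume (cornerTriangle V dir i lam) = ENNReal.ofReal (lam ^ 2 / 2) := by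
  obtain ⟨M, hM⟩ := h.exists_image_modelTriangle i
  rw [hM, volume_image_modelTriangle M _ hlam]

theorem mem_edge (h : IsDelzantPolygon V dir len) (i : Fin k) {c : ℝ} (hc : 0 ≤ c)
    (hc' : c ≤ len i) : (fun j => V i j + c * dir i j) ∈ convexHull ℝ (range V) := by
  obtain ⟨h₁, h₂⟩ := h.edgeDist_of_eq i (x := fun j => V i j + c * dir i j) (s := c) (t := 0)
    (fun j => by ring)
  refine h.mem_of_chord_le i (by rw [h₁]; exact hc) h₂.ge ?_
  rw [h₁, h₂, zero_div, add_zero]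
  exact (div_le_one (h.len_pos i)).mpr hc'

theorem mem_edge_prev (h : IsDelzantPolygon V dir len) (i : Fin k) {c : ℝ} (hc : 0 ≤ c)
    (hc' : c ≤ len (i - 1)) :
    (fun j => V i j - c * dir (i - 1) j) ∈ convexHull ℝ (range V) := by
  obtain ⟨h₁, h₂⟩ := h.edgeDist_of_eq i (x := fun j => V i j - c * dir (i - 1) j) (s := 0)
    (t := c) (fun j => by ring)
  refine h.mem_of_chord_le i h₁.ge (by rw [h₂]; exact hc) ?_
  rw [h₁, h₂, zero_div, zero_add]
  exact (div_le_one (h.len_pos (i - 1))).mpr hc'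

theorem isPackedTriangle_cornerTriangle (h : IsDelzantPolygon V dir len) {i : Fin k} {lam : ℝ}
    (h₀ : 0 < lam) (h₁ : lam ≤ len i) (h₂ : lam ≤ len (i - 1)) :
    IsPackedTriangle (convexHull ℝ (range V)) (V i) lam (cornerTriangle V dir i lam) := by
  obtain ⟨M, hM⟩ := h.exists_image_modelTriangle i
  refine ⟨h₀, h.cornerTriangle_subset h₁ h₂, ⟨M, hM lam⟩,
    {x | edgeDist V dir (i - 1) x + edgeDist V dir i x < lam}, ?_, ?_, ?_⟩
  · exact isOpen_lt ((continuous_edgeDist V dir (i - 1)).add (continuous_edgeDist V dir i))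
      continuous_const
  · simpa [h.edgeDist_prev_vertex, edgeDist_self] using h₀
  · ext x
    constructor
    · rintro ⟨hx, hxU⟩
      exact ⟨h.cornerTriangle_subset h₁ h₂ hx, hxU⟩
    · rintro ⟨hx, hxU⟩
      exact ⟨⟨h.edgeDist_nonneg _ hx, h.edgeDist_nonneg _ hx, hxU⟩, hxU⟩

/-- A lattice direction of the polygon at a vertex is a direction of a packed triangle there. -/
theorem det_nonneg_of_direction {Δ : Set Pt} {p : Pt} {lam ℓ : ℝ} {B : Set Pt}
    {M : Matrix.SpecialLinearGroup (Fin 2) ℤ}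
    (hM : B = (fun x => sl2Apply M x + p) '' modelTriangle lam) {U : Set Pt} (hU : IsOpen U)
    (hpU : p ∈ U) (hBU : B ∩ U = Δ ∩ U) (w : Fin 2 → ℤ) (hℓ : 0 < ℓ)
    (hw : ∀ c, 0 ≤ c → c ≤ ℓ → (fun j => p j + c * w j) ∈ Δ) :
    0 ≤ w 0 * M 1 1 - w 1 * M 0 1 ∧ 0 ≤ M 0 0 * w 1 - M 1 0 * w 0 := by
  have hcont : Continuous fun c : ℝ => (fun j => p j + c * w j : Pt) := by fun_prop
  have hev : ∀ᶠ c in nhds (0 : ℝ), (fun j => p j + c * w j : Pt) ∈ U := by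
    refine hcont.continuousAt.eventually_mem (hU.mem_nhds ?_)
    simpa using hpU
  obtain ⟨ε, hε, hball⟩ := Metric.eventually_nhds_iff.mp hev
  set c := min (ε / 2) ℓ with hc
  have hc0 : 0 < c := lt_min (half_pos hε) hℓ
  have hcU : (fun j => p j + c * w j : Pt) ∈ U := by
    refine hball ?_
    rw [Real.dist_eq, sub_zero, abs_of_pos hc0]
    exact (min_le_left _ _).trans_lt (half_lt_self hε)
  have hcB : (fun j => p j + c * w j : Pt) ∈ B :=
    (hBU.ge ⟨hw c hc0.le (min_le_right _ _), hcU⟩).1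
  rw [hM] at hcB
  obtain ⟨y, ⟨hy₀, hy₁, -⟩, hy⟩ := hcB
  have hdet : (M 0 0 * M 1 1 - M 0 1 * M 1 0 : ℝ) = 1 := by
    have := M.det_coe
    rw [Matrix.det_fin_two] at this
    exact_mod_cast this
  have e₀ : c * w 0 = M 0 0 * y 0 + M 0 1 * y 1 := by
    have := congrFun hy 0
    simp only [Pi.add_apply, sl2Apply_eq] at this
    linarith
  have e₁ : c * w 1 = M 1 0 * y 0 + M 1 1 * y 1 := by
    have := congrFun hy 1
    simp only [Pi.add_apply, sl2Apply_eq] at this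
    linarith
  have k₀ : c * (w 0 * M 1 1 - w 1 * M 0 1 : ℝ) = y 0 := by
    linear_combination (M 1 1 : ℝ) * e₀ - (M 0 1 : ℝ) * e₁ + y 0 * hdet
  have k₁ : c * (M 0 0 * w 1 - M 1 0 * w 0 : ℝ) = y 1 := by
    linear_combination (M 0 0 : ℝ) * e₁ - (M 1 0 : ℝ) * e₀ + y 1 * hdet
  constructor
  · exact_mod_cast nonneg_of_mul_nonneg_right (k₀.ge.trans' hy₀) hc0
  · exact_mod_cast nonneg_of_mul_nonneg_right (k₁.ge.trans' hy₁) hc0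

theorem eq_cornerTriangle (h : IsDelzantPolygon V dir len) {i : Fin k} {lam : ℝ} {B : Set Pt}
    (hB : IsPackedTriangle (convexHull ℝ (range V)) (V i) lam B) :
    B = cornerTriangle V dir i lam := by
  obtain ⟨hlam, hsub, ⟨M, hM⟩, U, hU, hpU, hBU⟩ := hB
  have hd := h.det_prev i
  have hdet : M 0 0 * M 1 1 - M 0 1 * M 1 0 = 1 := by
    have := M.det_coe
    rwa [Matrix.det_fin_two] at this
  have hu := det_nonneg_of_direction hM hU hpU hBU (dir i) (h.len_pos i)
    fun c => h.mem_edge i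
  have hv := det_nonneg_of_direction hM hU hpU hBU (fun j => -dir (i - 1) j)
    (h.len_pos (i - 1)) fun c hc hc' => by
      simpa [sub_eq_add_neg] using h.mem_edge_prev i hc hc'
  have hcol : ∀ m : Fin 2,
      0 ≤ dir (i - 1) 1 * M 0 m - dir (i - 1) 0 * M 1 m ∧
        0 ≤ dir i 1 * M 0 m - dir i 0 * M 1 m := by
    intro m
    have hy : (Pi.single m (lam / 2) : Pt) ∈ modelTriangle lam := by
      fin_cases m <;> simp [modelTriangle, hlam, (half_pos hlam).le]
    have hx := hsub (hM.ge (mem_image_of_mem _ hy))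
    have hlam2 : 0 < lam / 2 := half_pos hlam
    have key : ∀ l : Fin k, edgeDist V dir l (V i) = 0 →
        (0 : ℝ) ≤ dir l 1 * M 0 m - dir l 0 * M 1 m := by
      intro l hl
      have h₁ := h.edgeDist_nonneg l hx
      have h₂ : edgeDist V dir l (sl2Apply M (Pi.single m (lam / 2)) + V i) =
          lam / 2 * (dir l 1 * M 0 m - dir l 0 * M 1 m) := by
        rw [← sub_zero (edgeDist V dir l _), ← hl]
        simp only [edgeDist, Pi.add_apply, sl2Apply_eq]
        fin_cases m <;> simp <;> ring
      rw [h₂] at h₁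
      exact nonneg_of_mul_nonneg_right h₁ hlam2
    constructor
    · exact_mod_cast key _ (h.edgeDist_prev_vertex i)
    · exact_mod_cast key _ (edgeDist_self V dir i)
  have hα : dir (i - 1) 1 * M 0 0 - dir (i - 1) 0 * M 1 0 = 0 := by
    linarith [(hcol 0).1, hv.2]
  have hδ : dir i 1 * M 0 1 - dir i 0 * M 1 1 = 0 := by
    linarith [(hcol 1).2, hu.1]
  set β := dir i 1 * M 0 0 - dir i 0 * M 1 0 with hβ
  set γ := dir (i - 1) 1 * M 0 1 - dir (i - 1) 0 * M 1 1 with hγ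
  have e₀ : ∀ j, M j 0 = -β * dir (i - 1) j := by
    intro j
    rw [hβ]
    fin_cases j
    · simp only [Fin.zero_eta]
      linear_combination M 0 0 * hd + dir i 0 * hα
    · simp only [Fin.mk_one]
      linear_combination M 1 0 * hd + dir i 1 * hα
  have e₁ : ∀ j, M j 1 = γ * dir i j := by
    intro j
    rw [hγ]
    fin_cases j
    · simp only [Fin.zero_eta]
      linear_combination M 0 1 * hd - dir (i - 1) 0 * hδ
    · simp only [Fin.mk_one]
      linear_combination M 1 1 * hd - dir (i - 1) 1 * hδ
  have hβγ : β * γ = 1 := by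
    rw [e₀, e₀, e₁, e₁] at hdet
    linear_combination hdet + β * γ * hd
  obtain ⟨hβ1, hγ1⟩ | ⟨hβ1, -⟩ := Int.mul_eq_one_iff_eq_one_or_neg_one.mp hβγ
  · rw [hM]
    refine h.image_modelTriangle i (fun j => ?_) (fun j => ?_) lam
    · rw [e₀, hβ1]
      ring
    · rw [e₁, hγ1]
      ring
  · have := (hcol 0).2
    omega

theorem size_le_of_isPackedTriangle (h : IsDelzantPolygon V dir len) {i : Fin k} {lam : ℝ}
    {B : Set Pt} (hB : IsPackedTriangle (convexHull ℝ (range V)) (V i) lam B) :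
    lam ≤ len i ∧ lam ≤ len (i - 1) := by
  have hsub : cornerTriangle V dir i lam ⊆ convexHull ℝ (range V) :=
    h.eq_cornerTriangle hB ▸ hB.2.1
  constructor
  · by_contra! hlt
    obtain ⟨c, hc, hc'⟩ := exists_between hlt
    have hc0 := (h.len_pos i).trans hc
    obtain ⟨h₁, h₂⟩ := h.edgeDist_of_eq i (x := fun j => V i j + c * dir i j) (s := c) (t := 0)
      (fun j => by ring)
    refine hc.not_ge (h.le_len_of_mem i (hsub ⟨?_, ?_, ?_⟩) fun _ => rfl) <;>
      simp only [h₁, h₂] <;> linarith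
  · by_contra! hlt
    obtain ⟨c, hc, hc'⟩ := exists_between hlt
    have hc0 := (h.len_pos (i - 1)).trans hc
    obtain ⟨h₁, h₂⟩ := h.edgeDist_of_eq i (x := fun j => V i j - c * dir (i - 1) j) (s := 0)
      (t := c) (fun j => by ring)
    refine hc.not_ge (h.le_len_prev_of_mem i (hsub ⟨?_, ?_, ?_⟩) fun _ => rfl) <;>
      simp only [h₁, h₂] <;> linarith

/-- The lattice distances to three consecutive edges satisfy an affine relation. -/
theorem edgeDist_relation (h : IsDelzantPolygon V dir len) (i : Fin k) :
    ∃ n : ℤ, ∀ x, edgeDist V dir (i - 1) x + edgeDist V dir (i + 1) x +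
      n * edgeDist V dir i x = len i := by
  have hd := h.det_prev i
  have hd' := h.det_eq i
  refine ⟨dir (i - 1) 0 * dir (i + 1) 1 - dir (i - 1) 1 * dir (i + 1) 0, fun x => ?_⟩
  set n := dir (i - 1) 0 * dir (i + 1) 1 - dir (i - 1) 1 * dir (i + 1) 0 with hn
  have hsum : ∀ j, dir (i - 1) j + dir (i + 1) j = -n * dir i j := by
    intro j
    rw [hn]
    fin_cases j
    · simp only [Fin.zero_eta]
      linear_combination dir (i + 1) 0 * hd + dir (i - 1) 0 * hd'
    · simp only [Fin.mk_one]
      linear_combination dir (i + 1) 1 * hd + dir (i - 1) 1 * hd'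
  have hs : ∀ j, (dir (i - 1) j + dir (i + 1) j : ℝ) = -n * dir i j := by
    exact_mod_cast hsum
  have hdr := h.det_eq_real i
  rw [h.edgeDist_prev, edgeDist, edgeDist, h.vertex_add_one, h.vertex_add_one]
  linear_combination (x 0 - V i 0) * hs 1 - (x 1 - V i 1) * hs 0 - len i * hdr

theorem disjoint_cornerTriangle_add_one (h : IsDelzantPolygon V dir len) (i : Fin k) {a b : ℝ}
    (hab : a + b ≤ len i) (ha : a ≤ len (i - 1)) (hb : b ≤ len (i + 1)) :
    Disjoint (cornerTriangle V dir i a) (cornerTriangle V dir (i + 1) b) := by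
  rw [Set.disjoint_left]
  rintro x ⟨hx₀, hx₁, hx₂⟩ ⟨-, hx₃, hx₄⟩
  rw [add_sub_cancel_right] at hx₄
  obtain ⟨n, hn⟩ := h.edgeDist_relation i
  have h₁ := hn x
  have h₂ := hn (V (i - 1))
  have h₃ := hn (V (i + 1 + 1))
  rw [edgeDist_self, h.edgeDist_vertex_sub_one] at h₂
  have e := h.edgeDist_prev_vertex_add_one (i + 1)
  rw [add_sub_cancel_right] at e
  rw [h.edgeDist_vertex_add_one, e] at h₃
  have h₄ := h.edgeDist_nonneg (i + 1) (vertex_mem_convexHull V (i - 1))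
  have h₅ := h.edgeDist_nonneg (i - 1) (vertex_mem_convexHull V (i + 1 + 1))
  set y := edgeDist V dir i x with hy
  obtain hn2 | hn3 := le_or_gt n 2
  · have : (n : ℝ) ≤ 2 := by exact_mod_cast hn2
    have := mul_le_mul_of_nonneg_right this hx₁
    linarith
  · have hn3' : (3 : ℝ) ≤ n := by exact_mod_cast hn3
    have hna : (n : ℝ) * a ≤ len i := by nlinarith
    have hnb : (n : ℝ) * b ≤ len i := by nlinarith
    have hya : y < a := by linarith
    have hyb : y < b := by linarith
    obtain hle | hle := le_total a b <;> nlinarith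

theorem one_le_chord_of_mem_convexHull (h : IsDelzantPolygon V dir len)
    (hV : Function.Injective V) (i : Fin k) {s : Set Pt} (hs : s ⊆ V '' {i}ᶜ) {x : Pt}
    (hx : x ∈ convexHull ℝ s) :
    1 ≤ edgeDist V dir (i - 1) x / len i + edgeDist V dir i x / len (i - 1) := by
  refine convexHull_min (t := {x | 1 ≤ edgeDist V dir (i - 1) x / len i +
    edgeDist V dir i x / len (i - 1)}) ?_ ?_ hx
  · intro y hy
    obtain ⟨j, hj, rfl⟩ := hs hy
    exact h.one_le_chord_vertex hV hj
  · intro y hy z hz a b ha hb hab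
    simp only [mem_ofPred_eq, edgeDist_combo V dir _ hab] at hy hz ⊢
    have h₁ := mul_le_mul_of_nonneg_left hy ha
    have h₂ := mul_le_mul_of_nonneg_left hz hb
    calc (1 : ℝ) = a * 1 + b * 1 := by linarith
      _ ≤ _ := add_le_add h₁ h₂
      _ = _ := by ring

theorem cornerTriangle_subset_convexHull_neighbors (h : IsDelzantPolygon V dir len) {i : Fin k}
    {lam : ℝ} (h₁ : lam ≤ len i) (h₂ : lam ≤ len (i - 1)) :
    cornerTriangle V dir i lam ⊆ convexHull ℝ {V i, V (i + 1), V (i - 1)} :=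
  fun _ hx => h.mem_convexHull_of_chord_le i hx.1 hx.2.1
    (chord_lt_of_mem_cornerTriangle h₁ h₂ hx).le

theorem disjoint_cornerTriangle (h : IsDelzantPolygon V dir len) (hV : Function.Injective V)
    {sz : Fin k → ℝ} (hsz : ∀ i, 0 ≤ sz i ∧ sz i + sz (i + 1) ≤ len i) {i j : Fin k}
    (hij : i ≠ j) :
    Disjoint (cornerTriangle V dir i (sz i)) (cornerTriangle V dir j (sz j)) := by
  have hle : ∀ i, sz i ≤ len i := fun i => by linarith [(hsz i).2, (hsz (i + 1)).1]
  have hle' : ∀ i, sz i ≤ len (i - 1) := fun i => by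
    have := (hsz (i - 1)).2
    rw [sub_add_cancel] at this
    linarith [(hsz (i - 1)).1]
  by_cases h₁ : j = i + 1
  · subst h₁
    exact h.disjoint_cornerTriangle_add_one i (hsz i).2 (hle' i) (hle _)
  by_cases h₂ : i = j + 1
  · subst h₂
    exact (h.disjoint_cornerTriangle_add_one j (hsz j).2 (hle' j) (hle _)).symm
  rw [Set.disjoint_left]
  intro x hx hx'
  refine (chord_lt_of_mem_cornerTriangle (hle i) (hle' i) hx).not_ge ?_
  refine h.one_le_chord_of_mem_convexHull hV i ?_
    (h.cornerTriangle_subset_convexHull_neighbors (hle j) (hle' j) hx')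
  rintro _ (rfl | rfl | rfl)
  · exact ⟨j, hij.symm, rfl⟩
  · exact ⟨j + 1, Ne.symm h₂, rfl⟩
  · exact ⟨j - 1, fun he => h₁ (by rw [← show j - 1 = i from he, sub_add_cancel]), rfl⟩

theorem eq_iUnion_cornerTriangle (h : IsDelzantPolygon V dir len) {sz : Fin k → ℝ} {P : Set Pt}
    (hP : IsPacking V sz P) : P = ⋃ i, cornerTriangle V dir i (sz i) := by
  obtain ⟨tri, rfl, htri, -⟩ := hP
  refine iUnion_congr fun i => ?_
  obtain ⟨h₀, h₁⟩ | hB := htri i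
  · rw [h₀, h₁, cornerTriangle_zero]
  · exact h.eq_cornerTriangle hB

theorem mem_polytope_of_isPacking (h : IsDelzantPolygon V dir len) {sz : Fin k → ℝ} {P : Set Pt}
    (hP : IsPacking V sz P) (i : Fin k) : 0 ≤ sz i ∧ sz i + sz (i + 1) ≤ len i := by
  obtain ⟨tri, -, htri, hdisj⟩ := hP
  have hnonneg : ∀ i, 0 ≤ sz i := fun i => (htri i).elim (fun h => h.1.ge) fun h => h.1.le
  refine ⟨hnonneg i, ?_⟩
  obtain ⟨h₀, -⟩ | hB := htri i <;> obtain ⟨h₁, -⟩ | hB' := htri (i + 1)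
  · linarith [h.len_pos i]
  · have := (h.size_le_of_isPackedTriangle hB').2
    rw [add_sub_cancel_right] at this
    linarith
  · linarith [(h.size_le_of_isPackedTriangle hB).1]
  · have hle := (h.size_le_of_isPackedTriangle hB).1
    have hle' := (h.size_le_of_isPackedTriangle hB').2
    rw [add_sub_cancel_right] at hle'
    by_contra! hlt
    have hne : i ≠ i + 1 := Fin.self_ne_add_one (by linarith [h.three_le]) i
    have hd := hdisj hne
    rw [Function.onFun, h.eq_cornerTriangle hB, h.eq_cornerTriangle hB'] at hd
    set c := (len i - sz (i + 1) + sz i) / 2 with hc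
    obtain ⟨h₁, h₂⟩ := h.edgeDist_of_eq i (x := fun j => V i j + c * dir i j) (s := c) (t := 0)
      (fun j => by ring)
    obtain ⟨n, hn⟩ := h.edgeDist_relation i
    have h₃ := hn fun j => V i j + c * dir i j
    rw [h₁, h₂] at h₃
    refine Set.disjoint_left.mp hd (show (fun j => V i j + c * dir i j) ∈ _ from
      ⟨?_, ?_, ?_⟩) ⟨?_, ?_, ?_⟩ <;>
      (try rw [add_sub_cancel_right]) <;> linarith [hnonneg i]

theorem isPacking_iUnion_cornerTriangle (h : IsDelzantPolygon V dir len)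
    (hV : Function.Injective V) {sz : Fin k → ℝ}
    (hsz : ∀ i, 0 ≤ sz i ∧ sz i + sz (i + 1) ≤ len i) :
    IsPacking V sz (⋃ i, cornerTriangle V dir i (sz i)) := by
  refine ⟨_, rfl, fun i => ?_, fun i j hij => h.disjoint_cornerTriangle hV hsz hij⟩
  obtain h₀ | h₀ := (hsz i).1.eq_or_lt
  · exact Or.inl ⟨h₀.symm, by rw [← h₀, cornerTriangle_zero]⟩
  · have h₁ := (hsz (i - 1)).2
    rw [sub_add_cancel] at h₁
    exact Or.inr (h.isPackedTriangle_cornerTriangle h₀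
      (by linarith [(hsz i).2, (hsz (i + 1)).1]) (by linarith [(hsz (i - 1)).1]))

theorem size_le_of_iUnion_subset (h : IsDelzantPolygon V dir len) (hV : Function.Injective V)
    {sz sz' : Fin k → ℝ} (hsz : ∀ i, 0 ≤ sz i ∧ sz i + sz (i + 1) ≤ len i)
    (hsub : (⋃ i, cornerTriangle V dir i (sz' i)) ⊆ ⋃ i, cornerTriangle V dir i (sz i))
    (i : Fin k) : sz' i ≤ sz i := by
  by_contra! hlt
  obtain ⟨h₁, h₂⟩ := h.edgeDist_of_eq i (x := fun j => V i j + sz i * dir i j) (s := sz i)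
    (t := 0) (fun j => by ring)
  set x : Pt := fun j => V i j + sz i * dir i j with hx
  have hmem' : x ∈ cornerTriangle V dir i (sz' i) :=
    ⟨h₁.ge.trans' (hsz i).1, h₂.ge, by linarith⟩
  obtain ⟨j, hj⟩ := mem_iUnion.mp (hsub (mem_iUnion_of_mem i hmem'))
  have hle : sz j ≤ len j := by linarith [(hsz j).2, (hsz (j + 1)).1]
  have hle' : sz j ≤ len (j - 1) := by
    have := (hsz (j - 1)).2
    rw [sub_add_cancel] at this
    linarith [(hsz (j - 1)).1]
  by_cases hji : j = i
  · subst hji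
    linarith [hj.2.2]
  by_cases hji' : j = i + 1
  · subst hji'
    obtain ⟨n, hn⟩ := h.edgeDist_relation i
    have h₃ := hn x
    have h₄ := hj.2.2
    rw [add_sub_cancel_right] at h₄
    rw [h₁, h₂] at h₃
    linarith [(hsz i).2]
  refine (chord_lt_of_mem_cornerTriangle hle hle' hj).not_ge ?_
  refine h.one_le_chord_of_mem_convexHull hV j (s := {V i, V (i + 1)}) ?_ ?_
  · rintro _ (rfl | rfl)
    · exact ⟨i, Ne.symm hji, rfl⟩
    · exact ⟨i + 1, Ne.symm hji', rfl⟩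
  · rw [convexHull_pair]
    have hl := h.len_pos i
    have hs : sz i ≤ len i := by linarith [(hsz i).2, (hsz (i + 1)).1]
    refine ⟨1 - sz i / len i, sz i / len i, sub_nonneg.mpr ((div_le_one hl).mpr hs),
      div_nonneg (hsz i).1 hl.le, by ring, ?_⟩
    ext l
    simp only [hx, Pi.add_apply, Pi.smul_apply, smul_eq_mul]
    rw [h.vertex_add_one]
    field_simp
    ring

theorem area_iUnion_cornerTriangle (h : IsDelzantPolygon V dir len) (hV : Function.Injective V)
    {sz : Fin k → ℝ} (hsz : ∀ i, 0 ≤ sz i ∧ sz i + sz (i + 1) ≤ len i) :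
    area (⋃ i, cornerTriangle V dir i (sz i)) = (∑ i, sz i ^ 2) / 2 := by
  rw [area, measure_iUnion (fun i j hij => h.disjoint_cornerTriangle hV hsz hij)
    fun i => measurableSet_cornerTriangle V dir i _, tsum_fintype,
    ENNReal.toReal_sum fun i _ => by simp [h.volume_cornerTriangle i (hsz i).1],
    Finset.sum_div]
  refine Finset.sum_congr rfl fun i _ => ?_
  rw [h.volume_cornerTriangle i (hsz i).1, ENNReal.toReal_ofReal (by positivity)]

end IsDelzantPolygon

theorem isCompact_packingPolytope {k : ℕ} [NeZero k] (len : Fin k → ℝ) :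
    IsCompact {l : Fin k → ℝ | ∀ i, 0 ≤ l i ∧ l i + l (i + 1) ≤ len i} := by
  refine (isCompact_Icc (a := (0 : Fin k → ℝ)) (b := len)).of_isClosed_subset ?_ ?_
  · simp only [ofPred_forall]
    exact isClosed_iInter fun i =>
      (isClosed_le continuous_const (continuous_apply i)).inter
        (isClosed_le ((continuous_apply i).add (continuous_apply (i + 1))) continuous_const)
  · exact fun l hl => ⟨fun i => (hl i).1, fun i => by linarith [(hl i).2, (hl (i + 1)).1]⟩

theorem convex_packingPolytope {k : ℕ} [NeZero k] (len : Fin k → ℝ) :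
    Convex ℝ {l : Fin k → ℝ | ∀ i, 0 ≤ l i ∧ l i + l (i + 1) ≤ len i} := by
  intro x hx y hy a b ha hb hab i
  simp only [Pi.add_apply, Pi.smul_apply, smul_eq_mul]
  have h₁ := mul_nonneg ha (hx i).1
  have h₂ := mul_nonneg hb (hy i).1
  have h₃ := mul_le_mul_of_nonneg_left (hx i).2 ha
  have h₄ := mul_le_mul_of_nonneg_left (hy i).2 hb
  have h₅ : a * len i + b * len i = len i := by rw [← add_mul, hab, one_mul]
  constructor <;> linarith

/-- For a Delzant polygon with vertices `p₁, …, p_d` in clockwise order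
starting from the lexicographically minimal vertex and edge `SL₂(ℤ)`-lengths `ℓᵢ`, the map
`Λ` sending a packing to the tuple of `SL₂(ℤ)`-sizes of its triangles is a bijection from
`𝒫_T(Δ)` onto the compact convex polytope
`𝒫̃_T(Δ) = {λ : λᵢ ≥ 0, λᵢ + λᵢ₊₁ ≤ ℓᵢ}`, and `area P = ½ ‖Λ(P)‖²`. -/
theorem stmt3 (d : ℕ) [NeZero d] (V : Fin d → Pt) (dir : Fin d → Fin 2 → ℤ)
    (len : Fin d → ℝ) (hΔ : IsDelzantPolygon V dir len)
    (hlex : ∀ i : Fin d, i ≠ 0 →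
      V 0 0 < V i 0 ∨ (V 0 0 = V i 0 ∧ V 0 1 < V i 1)) :
    (∀ sz P, IsPacking V sz P →
        sz ∈ {l : Fin d → ℝ | ∀ i, 0 ≤ l i ∧ l i + l (i + 1) ≤ len i}) ∧
    (∀ sz ∈ {l : Fin d → ℝ | ∀ i, 0 ≤ l i ∧ l i + l (i + 1) ≤ len i},
        ∃ P, IsPacking V sz P) ∧
    (∀ sz sz' P, IsPacking V sz P → IsPacking V sz' P → sz = sz') ∧
    (∀ sz P P', IsPacking V sz P → IsPacking V sz P' → P = P') ∧
    (∀ sz P, IsPacking V sz P → area P = (∑ i, sz i ^ 2) / 2) ∧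
    IsCompact {l : Fin d → ℝ | ∀ i, 0 ≤ l i ∧ l i + l (i + 1) ≤ len i} ∧
    Convex ℝ {l : Fin d → ℝ | ∀ i, 0 ≤ l i ∧ l i + l (i + 1) ≤ len i} := by
  have hV : Function.Injective V := hΔ.vertex_injective fun i hi he => by
    have := hlex i hi
    simp [he] at this
  have hmem : ∀ sz P, IsPacking V sz P → ∀ i, 0 ≤ sz i ∧ sz i + sz (i + 1) ≤ len i :=
    fun sz P hP => hΔ.mem_polytope_of_isPacking hP
  refine ⟨hmem, fun sz hsz => ⟨_, hΔ.isPacking_iUnion_cornerTriangle hV hsz⟩, ?_, ?_, ?_,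
    isCompact_packingPolytope len, convex_packingPolytope len⟩
  · intro sz sz' P hP hP'
    have he := (hΔ.eq_iUnion_cornerTriangle hP).symm.trans (hΔ.eq_iUnion_cornerTriangle hP')
    ext i
    exact le_antisymm (hΔ.size_le_of_iUnion_subset hV (hmem _ _ hP') he.le i)
      (hΔ.size_le_of_iUnion_subset hV (hmem _ _ hP) he.ge i)
  · intro sz P P' hP hP'
    rw [hΔ.eq_iUnion_cornerTriangle hP, hΔ.eq_iUnion_cornerTriangle hP']
  · intro sz P hP
    rw [hΔ.eq_iUnion_cornerTriangle hP]
    exact hΔ.area_iUnion_cornerTriangle hV (hmem _ _ hP)
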